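/- Let d ≥ 1 and let P ⊆ ℝ^d be a compact convex d-polytope. Then for every target set A ⊆ ℝ^d the no-β McMullen game G_P(A) is equivalent to the perfect set game: player I has a winning strategy in G_P(A) if and only if A contains a perfect set, and player II has a winning strategy in G_P(A) if and only if A is countable. -/

import Mathlib

open Pointwise Filter Topology Set

/-- The set played by the move `c = (x, ρ)`: the translated scaled copy `x + ρ • P` of `P`. -/
def copySet {X : Type*} [AddCommGroup X] [Module ℝ X] (P : Set X) (c : X × ℝ) : Set X :=
  c.1 +ᵥ c.2 • P

/-- The rule that the `n`-th move of the run `m` must obey in the no-β McMullen game: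
every scaling factor is positive; player II's scaling factor is strictly smaller than that of
player I's preceding move; and each of player I's moves after the first is contained in his
previous move with player II's intervening move removed. -/
def Rule {X : Type*} [AddCommGroup X] [Module ℝ X] (P : Set X) (m : ℕ → X × ℝ) (n : ℕ) : Prop :=
  0 < (m n).2 ∧
    (if n % 2 = 1 then (m n).2 < (m (n - 1)).2
     else n ≠ 0 → copySet P (m n) ⊆ copySet P (m (n - 2)) \ copySet P (m (n - 1)))

/-- A strategy: a function assigning a next move to each finite position. -/
abbrev Strategy (X : Type*) := List (X × ℝ) → X × ℝ

/-- The run `m` is one in which player I follows the strategy `σ` (player I moves at the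
even rounds). -/
def FollowsI {X : Type*} (σ : Strategy X) (m : ℕ → X × ℝ) : Prop :=
  ∀ n, m (2 * n) = σ (List.ofFn fun i : Fin (2 * n) => m i)

/-- The run `m` is one in which player II follows the strategy `σ` (player II moves at the
odd rounds). -/
def FollowsII {X : Type*} (σ : Strategy X) (m : ℕ → X × ℝ) : Prop :=
  ∀ n, m (2 * n + 1) = σ (List.ofFn fun i : Fin (2 * n + 1) => m i)

/-- `σ` is a winning strategy for player I in the no-β McMullen game `G_P(A)`:
in every run in which player I follows `σ`, player I is never the first to violate the rules,
and if the run obeys all the rules then `(⋂ n, P_{2n}) ∩ A ≠ ∅`. -/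
def WinningI {X : Type*} [AddCommGroup X] [Module ℝ X] (P A : Set X) (σ : Strategy X) : Prop :=
  ∀ m : ℕ → X × ℝ, FollowsI σ m →
    (∀ n, (∀ k < 2 * n, Rule P m k) → Rule P m (2 * n)) ∧
    ((∀ n, Rule P m n) → ((⋂ n, copySet P (m (2 * n))) ∩ A).Nonempty)

/-- `σ` is a winning strategy for player II in the no-β McMullen game `G_P(A)`:
in every run in which player II follows `σ`, player II is never the first to violate the rules,
and if the run obeys all the rules then `(⋂ n, P_{2n}) ∩ A = ∅`. -/
def WinningII {X : Type*} [AddCommGroup X] [Module ℝ X] (P A : Set X) (σ : Strategy X) : Prop :=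
  ∀ m : ℕ → X × ℝ, FollowsII σ m →
    (∀ n, (∀ k < 2 * n + 1, Rule P m k) → Rule P m (2 * n + 1)) ∧
    ((∀ n, Rule P m n) → (⋂ n, copySet P (m (2 * n))) ∩ A = ∅)

/-- `A` contains a perfect set (a nonempty closed set with no isolated points). -/
def ContainsPerfectSet {X : Type*} [TopologicalSpace X] (A : Set X) : Prop :=
  ∃ F : Set X, F ⊆ A ∧ Perfect F ∧ F.Nonempty

open RealInnerProductSpace in
/-- A convex `d`-polytope in `ℝ^d`: a compact set with nonempty interior which is the
intersection of finitely many closed half-spaces. -/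
def IsPolytope (d : ℕ) (P : Set (EuclideanSpace ℝ (Fin d))) : Prop :=
  IsCompact P ∧ (interior P).Nonempty ∧
    ∃ (k : ℕ) (a : Fin k → EuclideanSpace ℝ (Fin d)) (b : Fin k → ℝ),
      (∀ i, a i ≠ 0) ∧ P = ⋂ i, {z | ⟪a i, z⟫ ≤ b i}

/-! ### Abstract combinatorial part -/

theorem ramsey_aux {E : Type*} [AddCommGroup E] (r : E → ℕ) (N : ℕ) (hN : ∀ x, r x ≤ N)
    (A : Set E) (hA : ¬ A.Countable) :
    ∃ n, ∃ Y ⊆ A, ¬ Y.Countable ∧ (∀ u ∈ Y, ∀ v ∈ Y, u ≠ v → n ≤ r (v - u)) ∧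
      ∀ Y' ⊆ Y, ¬ Y'.Countable → ∃ u ∈ Y', ∃ v ∈ Y', u ≠ v ∧ r (v - u) = n := by
  classical
  let Q : ℕ → Prop := fun n => ∃ Y ⊆ A, ¬ Y.Countable ∧
    (∀ u ∈ Y, ∀ v ∈ Y, u ≠ v → n ≤ r (v - u))
  have h0 : Q 0 := ⟨A, Subset.rfl, hA, fun _ _ _ _ _ => Nat.zero_le _⟩
  have hb : ∀ n, Q n → n ≤ N := by
    rintro n ⟨Y, -, hY, h⟩
    have : Y.Nontrivial := by
      by_contra hn
      exact hY (Set.not_nontrivial_iff.1 hn).countable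
    obtain ⟨u, hu, v, hv, huv⟩ := this
    exact (h u hu v hv huv).trans (hN _)
  have hQ : Q (Nat.findGreatest Q N) := Nat.findGreatest_spec (Nat.zero_le _) h0
  obtain ⟨Y, hYA, hY, h⟩ := hQ
  refine ⟨_, Y, hYA, hY, h, fun Y' hY' hc => ?_⟩
  by_contra hcon
  push Not at hcon
  have : Q (Nat.findGreatest Q N + 1) := by
    refine ⟨Y', hY'.trans hYA, hc, fun u hu v hv huv => ?_⟩
    have h1 := h u (hY' hu) v (hY' hv) huv
    have h2 := hcon u hu v hv huv
    omega
  have h3 := Nat.le_findGreatest (hb _ this) this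
  omega

/-- A countable cover argument. -/
theorem uncountable_ball {E : Type*} [PseudoMetricSpace E] [SecondCountableTopology E]
    (D : Set E) (hD : ¬ D.Countable) (ε : ℝ) (hε : 0 < ε) :
    ∃ x, ¬ (D ∩ Metric.ball x ε).Countable := by
  by_contra hcon
  push Not at hcon
  obtain ⟨s, hs, hU⟩ := TopologicalSpace.countable_cover_nhds
    (f := fun x : E => Metric.ball x ε) (fun x => Metric.ball_mem_nhds x hε)
  apply hD
  have : D = ⋃ x ∈ s, D ∩ Metric.ball x ε := by
    rw [← Set.inter_iUnion₂, hU, Set.inter_univ]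
  rw [this]
  exact hs.biUnion (fun x _ => hcon x)

theorem good_set {E : Type*} [NormedAddCommGroup E] [SecondCountableTopology E]
    (r : E → ℕ) (husc : ∀ w, ∀ᶠ w' in 𝓝 w, r w' ≤ r w)
    (Small : Set E → Prop) (hmono : ∀ s t, s ⊆ t → Small t → Small s)
    (hunion : ∀ S : Set (Set E), S.Countable → (∀ s ∈ S, Small s) → Small (⋃₀ S))
    (hcount : ∀ s : Set E, s.Countable → Small s)
    (n : ℕ) (Y : Set E) (hYs : ¬ Small Y)
    (h1 : ∀ u ∈ Y, ∀ v ∈ Y, u ≠ v → n ≤ r (v - u))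
    (h2 : ∀ Y' ⊆ Y, ¬ Y'.Countable → ∃ u ∈ Y', ∃ v ∈ Y', u ≠ v ∧ r (v - u) = n) :
    ∃ G ⊆ Y, ¬ Small G ∧ ∀ u ∈ G, ∀ ε > 0,
      ¬ Small {v | v ∈ G ∧ v ≠ u ∧ dist v u < ε ∧ r (v - u) = n} ∧
      ¬ Small {v | v ∈ G ∧ v ≠ u ∧ dist v u < ε ∧ r (u - v) = n} := by
  have hun2 : ∀ s t, Small s → Small t → Small (s ∪ t) := by
    intro s t hs ht
    have := hunion {s, t} (Set.countable_insert.2 (Set.countable_singleton t)) (by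
      rintro x (rfl | rfl) <;> assumption)
    rwa [Set.sUnion_pair] at this
  let Y1 : Set E := {a | a ∈ Y ∧ ∀ N ∈ 𝓝 a, ¬ Small (N ∩ Y)}
  have hY1Y : Y1 ⊆ Y := fun a ha => ha.1
  have hdiff : Small (Y \ Y1) := by
    refine hmono _ (⋃₀ ((fun b => b ∩ Y) '' {b ∈ TopologicalSpace.countableBasis E | Small (b ∩ Y)})) ?_ (hunion _ ?_ ?_)
    · rintro a ⟨haY, ha1⟩
      have : ∃ N ∈ 𝓝 a, Small (N ∩ Y) := by
        by_contra hc
        push Not at hc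
        exact ha1 ⟨haY, hc⟩
      obtain ⟨N, hN, hS⟩ := this
      obtain ⟨b, hb, hab, hbN⟩ := (TopologicalSpace.isBasis_countableBasis E).mem_nhds_iff.1 hN
      exact ⟨b ∩ Y, ⟨b, ⟨hb, hmono _ _ (Set.inter_subset_inter_left _ hbN) hS⟩, rfl⟩, hab, haY⟩
    · exact ((TopologicalSpace.countable_countableBasis E).mono (fun b hb => hb.1)).image _
    · rintro _ ⟨b, hb, rfl⟩
      exact hb.2
  have hY1s : ¬ Small Y1 := fun h => hYs
    (hmono _ _ (fun a ha => by
      by_cases h : a ∈ Y1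
      · exact Or.inl h
      · exact Or.inr ⟨ha, h⟩) (hun2 _ _ h hdiff))
  have hloc : ∀ a ∈ Y1, ∀ N ∈ 𝓝 a, ¬ Small (N ∩ Y1) := fun a ha N hN h => ha.2 N hN
    (hmono _ _ (fun x hx => by
      by_cases h : x ∈ Y1
      · exact Or.inl ⟨hx.1, h⟩
      · exact Or.inr ⟨hx.2, h⟩) (hun2 _ _ h hdiff))
  let Dp : ℕ → Set E := fun k => {u | u ∈ Y1 ∧ ¬ ∃ v ∈ Y1, v ≠ u ∧ dist v u < 1 / ((k : ℝ) + 1) ∧ r (v - u) = n}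
  let Dm : ℕ → Set E := fun k => {u | u ∈ Y1 ∧ ¬ ∃ v ∈ Y1, v ≠ u ∧ dist v u < 1 / ((k : ℝ) + 1) ∧ r (u - v) = n}
  have key : ∀ (k : ℕ) (D : Set E), D ⊆ Y1 → ¬ D.Countable → ∃ u ∈ D, ∃ v ∈ D, u ≠ v ∧
      r (v - u) = n ∧ dist v u < 1 / ((k : ℝ) + 1) := by
    intro k D hD hc
    obtain ⟨x, hx⟩ := uncountable_ball D hc (1 / ((k : ℝ) + 1) / 2) (by positivity)
    obtain ⟨u, hu, v, hv, huv, hr⟩ := h2 _ (Set.inter_subset_left.trans (hD.trans hY1Y)) hx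
    refine ⟨u, hu.1, v, hv.1, huv, hr, ?_⟩
    have a1 := Metric.mem_ball.1 hu.2
    have a2 := Metric.mem_ball.1 hv.2
    have := dist_triangle_right v u x
    linarith
  have hDp : ∀ k, (Dp k).Countable := by
    intro k
    by_contra hc
    obtain ⟨u, hu, v, hv, huv, hr, hd⟩ := key k (Dp k) (fun a ha => ha.1) hc
    exact hu.2 ⟨v, hv.1, huv.symm, hd, hr⟩
  have hDm : ∀ k, (Dm k).Countable := by
    intro k
    by_contra hc
    obtain ⟨u, hu, v, hv, huv, hr, hd⟩ := key k (Dm k) (fun a ha => ha.1) hc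
    exact hv.2 ⟨u, hu.1, huv, by rwa [dist_comm], hr⟩
  let B : Set E := (⋃ k, Dp k) ∪ ⋃ k, Dm k
  have hB : B.Countable := (Set.countable_iUnion hDp).union (Set.countable_iUnion hDm)
  have hsub : ∀ s, ¬ Small s → ¬ Small (s \ B) := fun s hs h => hs
    (hmono _ _ (fun a ha => by
      by_cases h : a ∈ B
      · exact Or.inr h
      · exact Or.inl ⟨ha, h⟩) (hun2 _ _ h (hcount _ hB)))
  refine ⟨Y1 \ B, fun a ha => ha.1.1, hsub _ hY1s, ?_⟩
  rintro u ⟨huY, huB⟩ ε hε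
  obtain ⟨k, hk⟩ := exists_nat_one_div_lt hε
  have gen : ∀ f : E → E, Continuous f → (∀ v ∈ Y1, v ≠ u → n ≤ r (f v)) →
      (∃ v ∈ Y1, v ≠ u ∧ dist v u < 1 / ((k : ℝ) + 1) ∧ r (f v) = n) →
      ¬ Small {v | v ∈ Y1 \ B ∧ v ≠ u ∧ dist v u < ε ∧ r (f v) = n} := by
    rintro f hf hle ⟨v, hvY, hvu, hd, hr⟩ hS
    have e1 : ∀ᶠ v' in 𝓝 v, r (f v') ≤ n := by
      have := hf.continuousAt.eventually (husc (f v))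
      rwa [hr] at this
    have e2 : ∀ᶠ v' in 𝓝 v, v' ≠ u := isOpen_ne.eventually_mem hvu
    have e3 : ∀ᶠ v' in 𝓝 v, dist v' u < ε :=
      (continuous_id.dist continuous_const).continuousAt.eventually_lt_const (hd.trans hk)
    refine hsub _ (hloc v hvY _ (e1.and (e2.and e3))) (hmono _ _ ?_ hS)
    rintro x ⟨⟨⟨hx1, hx2, hx3⟩, hxY⟩, hxB⟩
    exact ⟨⟨hxY, hxB⟩, hx2, hx3, le_antisymm hx1 (hle x hxY hx2)⟩
  constructor
  · refine gen (fun v => v - u) (by fun_prop) (fun v hv hvu => h1 u huY.1 v hv.1 hvu.symm) ?_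
    by_contra hc
    exact huB (Or.inl (Set.mem_iUnion.2 ⟨k, huY, hc⟩))
  · refine gen (fun v => u - v) (by fun_prop) (fun v hv hvu => h1 v hv.1 u huY.1 hvu) ?_
    by_contra hc
    exact huB (Or.inr (Set.mem_iUnion.2 ⟨k, huY, hc⟩))

theorem exists_play {α : Type*} (f : List α → α) :
    ∃ m : ℕ → α, ∀ n, m n = f (List.ofFn fun i : Fin n => m i) := by
  let L : ℕ → List α := fun n => Nat.rec [] (fun _ l => l ++ [f l]) n
  have hL : ∀ n, L (n + 1) = L n ++ [f (L n)] := fun n => rfl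
  refine ⟨fun n => f (L n), fun n => ?_⟩
  have : L n = List.ofFn fun i : Fin n => f (L i) := by
    induction n with
    | zero => rfl
    | succ n ih =>
      rw [hL, List.ofFn_succ', List.concat_eq_append]
      simp only [Fin.val_castSucc, Fin.val_last]
      rw [← ih]
  rw [← this]

/-! ### Geometry of copies -/

theorem mem_copySet' {E : Type*} [AddCommGroup E] [Module ℝ E] {P : Set E} {c : E × ℝ} {z : E} :
    z ∈ copySet P c ↔ ∃ p ∈ P, z = c.1 + c.2 • p := by
  unfold copySet
  rw [Set.mem_vadd_set]
  constructor
  · rintro ⟨y, hy, rfl⟩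
    obtain ⟨p, hp, rfl⟩ := Set.mem_smul_set.1 hy
    exact ⟨p, hp, rfl⟩
  · rintro ⟨p, hp, rfl⟩
    exact ⟨c.2 • p, Set.smul_mem_smul_set hp, rfl⟩

section geom
variable {E : Type*} [NormedAddCommGroup E] [InnerProductSpace ℝ E]

theorem mem_copySet_iff {P : Set E} {k : ℕ} {a : Fin k → E} {b : Fin k → ℝ}
    (hPeq : ∀ z, z ∈ P ↔ ∀ i, inner ℝ (a i) z ≤ b i) {c : E × ℝ} (hc : 0 < c.2) {z : E} :
    z ∈ copySet P c ↔ ∀ i, inner ℝ (a i) z ≤ inner ℝ (a i) c.1 + c.2 * b i := by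
  rw [mem_copySet']
  constructor
  · rintro ⟨p, hp, rfl⟩ i
    rw [inner_add_right, inner_smul_right]
    have := (hPeq p).1 hp i
    gcongr
  · intro h
    refine ⟨c.2⁻¹ • (z - c.1), (hPeq _).2 fun i => ?_, ?_⟩
    · rw [inner_smul_right, inner_sub_right, inv_mul_le_iff₀ hc]
      linarith [h i]
    · rw [smul_inv_smul₀ hc.ne']
      abel

theorem isCompact_copySet {P : Set E} (hP : IsCompact P) (c : E × ℝ) :
    IsCompact (copySet P c) := by
  have : copySet P c = (fun p => c.1 + c.2 • p) '' P := by
    ext z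
    rw [mem_copySet']
    constructor
    · rintro ⟨p, hp, rfl⟩; exact ⟨p, hp, rfl⟩
    · rintro ⟨p, hp, rfl⟩; exact ⟨p, hp, rfl⟩
  rw [this]
  exact hP.image (by fun_prop)

/-- Active constraints of the copy `c` at `z`. -/
def ActAt {k : ℕ} (a : Fin k → E) (b : Fin k → ℝ) (c : E × ℝ) (z : E) (j : Fin k) : Prop :=
  inner ℝ (a j) z = inner ℝ (a j) c.1 + c.2 * b j

theorem fit {P : Set E} (hPc : IsCompact P) {k : ℕ} {a : Fin k → E} {b : Fin k → ℝ}
    (hPeq : ∀ z, z ∈ P ↔ ∀ i, inner ℝ (a i) z ≤ b i) {c : E × ℝ} (hc : 0 < c.2) {z : E}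
    (hz : z ∈ copySet P c) (T : Set E) (hT : IsClosed T) (hzT : z ∉ T) :
    ∃ ε > 0, ∀ c' : E × ℝ, 0 < c'.2 → c'.2 < ε → z ∈ copySet P c' →
      (∀ j, ActAt a b c z j → ActAt a b c' z j) → copySet P c' ⊆ copySet P c \ T := by
  have e : ∀ᶠ y in 𝓝 z, (∀ j, ¬ ActAt a b c z j → inner ℝ (a j) y < inner ℝ (a j) c.1 + c.2 * b j)
      ∧ y ∉ T := by
    refine Filter.Eventually.and ?_ (hT.isOpen_compl.eventually_mem hzT)
    rw [Filter.eventually_all]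
    intro j
    by_cases hj : ActAt a b c z j
    · exact Filter.Eventually.of_forall fun y h => absurd hj h
    · have hlt : inner ℝ (a j) z < inner ℝ (a j) c.1 + c.2 * b j :=
        lt_of_le_of_ne ((mem_copySet_iff hPeq hc).1 hz j) hj
      have : Continuous fun y : E => inner ℝ (a j) y := by fun_prop
      filter_upwards [this.continuousAt.eventually_lt_const hlt] with y hy _ using hy
  obtain ⟨δ, hδ, hball⟩ := Metric.eventually_nhds_iff.1 e
  obtain ⟨M, hM⟩ := hPc.isBounded.exists_norm_le
  have hM0 : 0 < |M| + 1 := by positivity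
  refine ⟨δ / (2 * (|M| + 1)), by positivity, fun c' hc' hlt hzc' hact y hy => ?_⟩
  have hd : dist y z < δ := by
    obtain ⟨p, hp, rfl⟩ := mem_copySet'.1 hy
    obtain ⟨q, hq, rfl⟩ := mem_copySet'.1 hzc'
    rw [dist_add_left, dist_eq_norm, ← smul_sub, norm_smul, Real.norm_of_nonneg hc'.le]
    have h1 : ‖p - q‖ ≤ 2 * (|M| + 1) := by
      have := norm_sub_le p q
      have := hM p hp
      have := hM q hq
      have := le_abs_self M
      linarith
    calc c'.2 * ‖p - q‖ ≤ c'.2 * (2 * (|M| + 1)) := by gcongr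
      _ < δ := by rwa [lt_div_iff₀ (by positivity)] at hlt
  obtain ⟨g1, g2⟩ := hball hd
  refine ⟨(mem_copySet_iff hPeq hc).2 fun j => ?_, g2⟩
  by_cases hj : ActAt a b c z j
  · have h1 := (mem_copySet_iff hPeq hc').1 hy j
    have h2 := hact j hj
    unfold ActAt at hj h2
    linarith
  · exact (g1 j hj).le

/-- Shrinking lemma. -/
theorem shrink {P : Set E} (hPc : IsCompact P) {k : ℕ} {a : Fin k → E} {b : Fin k → ℝ}
    (hPeq : ∀ z, z ∈ P ↔ ∀ i, inner ℝ (a i) z ≤ b i) {p0 : E} (hp0 : p0 ∈ P) {c c' : E × ℝ}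
    (hc : 0 < c.2) (hc' : 0 < c'.2)
    (hsub : copySet P c' ⊆ copySet P c \ copySet P (c.1 + (c.2 / 2) • p0, c.2 / 2)) :
    c'.2 < c.2 / 2 := by
  by_contra hlt
  push Not at hlt
  have hmem : c'.1 + c'.2 • p0 ∈ copySet P c' := mem_copySet'.2 ⟨p0, hp0, rfl⟩
  refine (hsub hmem).2 ?_
  refine (mem_copySet_iff hPeq (by simpa using hc)).2 fun i => ?_
  obtain ⟨z, hz, hmax⟩ := hPc.exists_isMaxOn ⟨p0, hp0⟩
    (f := fun y : E => inner ℝ (a i) y) (by fun_prop)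
  have hmax' : ∀ y ∈ P, inner ℝ (a i) y ≤ inner ℝ (a i) z := fun y hy => hmax hy
  have h1 : c'.1 + c'.2 • z ∈ copySet P c := (hsub (mem_copySet'.2 ⟨z, hz, rfl⟩)).1
  obtain ⟨y, hy, hyeq⟩ := mem_copySet'.1 h1
  have h2 : inner ℝ (a i) (c'.1 + c'.2 • z) = inner ℝ (a i) (c.1 + c.2 • y) := by rw [hyeq]
  simp only [inner_add_right, inner_smul_right] at h2 ⊢
  have h3 := hmax' y hy
  have h4 := hmax' p0 hp0
  have h5 := (hPeq z).1 hz i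
  have h6 : c.2 * inner ℝ (a i) y ≤ c.2 * inner ℝ (a i) z := by gcongr
  have h7 : (c'.2 - c.2 / 2) * inner ℝ (a i) p0 ≤ (c'.2 - c.2 / 2) * inner ℝ (a i) z := by
    gcongr
  have h8 : (c.2 / 2) * inner ℝ (a i) z ≤ (c.2 / 2) * b i := by gcongr
  linarith

theorem chord_data {P : Set E} (hPc : IsCompact P) (hPi : (interior P).Nonempty)
    (hconv : Convex ℝ P) {k : ℕ} (a : Fin k → E) (b : Fin k → ℝ) :
    ∃ (g : E → ℝ) (r : E → ℕ) (N : ℕ), Continuous g ∧ g 0 = 0 ∧ (∀ w, w ≠ 0 → 0 < g w) ∧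
      (∀ x, r x ≤ N) ∧ (∀ w, ∀ᶠ w' in 𝓝 w, r w' ≤ r w) ∧
      (∀ n, ∃ J J' : Set (Fin k), ∀ w, r w = n → ∃ p ∈ P, ∃ q ∈ P, w = g w • (q - p) ∧
        (∀ j, j ∈ J ↔ inner ℝ (a j) p = b j) ∧ (∀ j, j ∈ J' ↔ inner ℝ (a j) q = b j)) ∧
      (∀ u v (c : E × ℝ), 0 < c.2 → u ∈ copySet P c → v ∈ copySet P c → g (v - u) ≤ c.2) := by
  classical
  have hDcomp : IsCompact (P - P) := by
    rw [← Set.sub_image_prod]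
    exact (hPc.prod hPc).image continuous_sub
  have hDconv : Convex ℝ (P - P) := hconv.sub hconv
  obtain ⟨o, ho⟩ := hPi
  have hoP : o ∈ P := interior_subset ho
  have hD0 : P - P ∈ 𝓝 (0 : E) := by
    have h1 : P ∈ 𝓝 o := mem_interior_iff_mem_nhds.1 ho
    have h2 : ∀ᶠ w in 𝓝 (0 : E), w + o ∈ P := by
      have : Tendsto (fun w : E => w + o) (𝓝 0) (𝓝 o) := by
        have h : Continuous fun w : E => w + o := by fun_prop
        simpa using h.tendsto (0 : E)
      exact this h1
    filter_upwards [h2] with w hw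
    exact Set.mem_sub.2 ⟨w + o, hw, o, hoP, by abel⟩
  let g := gauge (P - P)
  have hg : Continuous g := continuous_gauge hDconv hD0
  have hgpos : ∀ w, w ≠ 0 → 0 < g w := fun w hw =>
    (gauge_pos (absorbent_nhds_zero hD0)
      (NormedSpace.isVonNBounded_of_isBounded ℝ hDcomp.isBounded)).2 hw
  have hch : ∀ w, ∃ p ∈ P, ∃ q ∈ P, w = g w • (q - p) := by
    intro w
    by_cases hw : w = 0
    · subst hw
      exact ⟨o, hoP, o, hoP, by simp⟩
    · have hp := hgpos w hw
      have h1 : g ((g w)⁻¹ • w) ≤ 1 := by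
        have : g ((g w)⁻¹ • w) = (g w)⁻¹ * g w := gauge_smul_of_nonneg (by positivity) w
        rw [this, inv_mul_cancel₀ hp.ne']
      have h2 := (gauge_le_one_iff_mem_closure hDconv hD0).1 h1
      rw [hDcomp.isClosed.closure_eq] at h2
      obtain ⟨q, hq, p, hp', hqp⟩ := Set.mem_sub.1 h2
      refine ⟨p, hp', q, hq, ?_⟩
      rw [hqp, smul_inv_smul₀ hp.ne']
  -- closed classes
  let C : Finset (Fin k) × Finset (Fin k) → Set E := fun τ =>
    {w | ∃ p ∈ P, ∃ q ∈ P, w = g w • (q - p) ∧ (∀ j ∈ τ.1, inner ℝ (a j) p = b j) ∧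
      (∀ j ∈ τ.2, inner ℝ (a j) q = b j)}
  have hC : ∀ τ, IsClosed (C τ) := by
    intro τ
    have : CompactSpace P := isCompact_iff_compactSpace.1 hPc
    let Z : Set (E × (P × P)) := {x | x.1 = g x.1 • ((x.2.2 : E) - x.2.1)} ∩
      ((⋂ j ∈ τ.1, {x | inner ℝ (a j) (x.2.1 : E) = b j}) ∩
      (⋂ j ∈ τ.2, {x | inner ℝ (a j) (x.2.2 : E) = b j}))
    have hZ : IsClosed Z := by
      refine IsClosed.inter (isClosed_eq (by fun_prop) (by fun_prop)) (IsClosed.inter ?_ ?_)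
      · exact isClosed_biInter fun j _ => isClosed_eq (by fun_prop) (by fun_prop)
      · exact isClosed_biInter fun j _ => isClosed_eq (by fun_prop) (by fun_prop)
    have : C τ = Prod.fst '' Z := by
      ext w
      constructor
      · rintro ⟨p, hp, q, hq, h1, h2, h3⟩
        refine ⟨(w, (⟨p, hp⟩, ⟨q, hq⟩)), ⟨h1, ?_, ?_⟩, rfl⟩
        · simpa using h2
        · simpa using h3
      · rintro ⟨⟨w', p, q⟩, ⟨h1, h2, h3⟩, rfl⟩
        refine ⟨p, p.2, q, q.2, h1, ?_, ?_⟩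
        · simpa using h2
        · simpa using h3
    rw [this]
    exact isClosedMap_fst_of_compactSpace _ hZ
  let Ty := Finset (Fin k) × Finset (Fin k)
  let S : E → Finset Ty := fun w => Finset.univ.filter fun τ => w ∈ C τ
  let em : Ty ↪ ℕ := (Fintype.equivFin Ty).toEmbedding.trans Fin.valEmbedding
  let rk : Finset Ty → ℕ := fun s => ∑ i ∈ s.map em, 2 ^ i
  have rkinj : Function.Injective rk := fun s t h =>
    Finset.map_injective em (Finset.geomSum_injective le_rfl h)
  have rkmono : ∀ s t, s ⊆ t → rk s ≤ rk t := fun s t h =>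
    Finset.sum_le_sum_of_subset (Finset.map_subset_map.2 h)
  refine ⟨g, fun w => rk (S w), rk Finset.univ, hg, gauge_zero, hgpos,
    fun x => rkmono _ _ (Finset.subset_univ _), ?_, ?_, ?_⟩
  · intro w
    have : ∀ᶠ w' in 𝓝 w, ∀ τ, w ∉ C τ → w' ∉ C τ := by
      rw [Filter.eventually_all]
      intro τ
      by_cases hτ : w ∈ C τ
      · exact Filter.Eventually.of_forall fun y h => absurd hτ h
      · filter_upwards [(hC τ).isOpen_compl.eventually_mem hτ] with y hy _ using hy
    filter_upwards [this] with w' hw'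
    refine rkmono _ _ fun τ hτ => ?_
    simp only [S, Finset.mem_filter, Finset.mem_univ, true_and] at hτ ⊢
    by_contra hc
    exact hw' τ hc hτ
  · intro n
    by_cases hn : ∃ w0, rk (S w0) = n
    · obtain ⟨w0, hw0⟩ := hn
      have hne : (S w0).Nonempty := by
        obtain ⟨p, hp, q, hq, h⟩ := hch w0
        refine ⟨(∅, ∅), ?_⟩
        simp only [S, Finset.mem_filter, Finset.mem_univ, true_and]
        exact ⟨p, hp, q, hq, h, by simp, by simp⟩
      obtain ⟨τ, hτ, hmax⟩ := Finset.exists_max_image (S w0) (fun τ => τ.1.card + τ.2.card) hne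
      refine ⟨↑τ.1, ↑τ.2, fun w hw => ?_⟩
      have hS : S w = S w0 := rkinj (hw.trans hw0.symm)
      have hwτ : w ∈ C τ := by
        rw [← hS] at hτ
        simpa [S] using hτ
      obtain ⟨p, hp, q, hq, h1, h2, h3⟩ := hwτ
      let σ : Ty := (Finset.univ.filter fun j => inner ℝ (a j) p = b j,
        Finset.univ.filter fun j => inner ℝ (a j) q = b j)
      have hσ : σ ∈ S w0 := by
        rw [← hS]
        simp only [S, Finset.mem_filter, Finset.mem_univ, true_and]
        exact ⟨p, hp, q, hq, h1, by simp [σ], by simp [σ]⟩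
      have hcard := hmax σ hσ
      have s1 : τ.1 ⊆ σ.1 := fun j hj => by simpa [σ] using h2 j hj
      have s2 : τ.2 ⊆ σ.2 := fun j hj => by simpa [σ] using h3 j hj
      have c1 := Finset.card_le_card s1
      have c2 := Finset.card_le_card s2
      have e1 : τ.1 = σ.1 := Finset.eq_of_subset_of_card_le s1 (by omega)
      have e2 : τ.2 = σ.2 := Finset.eq_of_subset_of_card_le s2 (by omega)
      refine ⟨p, hp, q, hq, h1, fun j => ?_, fun j => ?_⟩
      · rw [e1]; simp [σ]
      · rw [e2]; simp [σ]
    · exact ⟨∅, ∅, fun w hw => absurd ⟨w, hw⟩ hn⟩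
  · intro u v c hc hu hv
    obtain ⟨p, hp, rfl⟩ := mem_copySet'.1 hu
    obtain ⟨q, hq, rfl⟩ := mem_copySet'.1 hv
    refine gauge_le_of_mem hc.le ?_
    refine Set.mem_smul_set.2 ⟨q - p, Set.sub_mem_sub hq hp, ?_⟩
    rw [smul_sub]
    abel

end geom

section sys
variable {E : Type*} [NormedAddCommGroup E] [InnerProductSpace ℝ E]

structure ChordSys (P : Set E) {k : ℕ} (a : Fin k → E) (b : Fin k → ℝ) (g : E → ℝ) (r : E → ℕ)
    (n : ℕ) (J J' : Set (Fin k)) : Prop where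
  hPc : IsCompact P
  hPeq : ∀ z, z ∈ P ↔ ∀ i, inner ℝ (a i) z ≤ b i
  gcont : Continuous g
  g0 : g 0 = 0
  gpos : ∀ w, w ≠ 0 → 0 < g w
  hch : ∀ w, r w = n → ∃ p ∈ P, ∃ q ∈ P, w = g w • (q - p) ∧
        (∀ j, j ∈ J ↔ inner ℝ (a j) p = b j) ∧ (∀ j, j ∈ J' ↔ inner ℝ (a j) q = b j)
  hcov : ∀ u v (c : E × ℝ), 0 < c.2 → u ∈ copySet P c → v ∈ copySet P c → g (v - u) ≤ c.2

structure Chord (P : Set E) {k : ℕ} (a : Fin k → E) (b : Fin k → ℝ) (g : E → ℝ)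
    (J J' : Set (Fin k)) (c : E × ℝ) (u v : E) : Prop where
  pos : 0 < c.2
  eq : c.2 = g (v - u)
  hu : u ∈ copySet P c
  hv : v ∈ copySet P c
  au : ∀ j, ActAt a b c u j ↔ j ∈ J
  av : ∀ j, ActAt a b c v j ↔ j ∈ J'

variable {P : Set E} {k : ℕ} {a : Fin k → E} {b : Fin k → ℝ} {g : E → ℝ} {r : E → ℕ}
    {n : ℕ} {J J' : Set (Fin k)}

theorem ChordSys.place (H : ChordSys P a b g r n J J') {u v : E} (huv : v ≠ u)
    (hr : r (v - u) = n) : ∃ c, Chord P a b g J J' c u v := by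
  obtain ⟨p, hp, q, hq, h1, h2, h3⟩ := H.hch _ hr
  have hpos := H.gpos _ (sub_ne_zero.2 huv)
  have hu : u = (u - g (v - u) • p) + g (v - u) • p := by abel
  have hv : v = (u - g (v - u) • p) + g (v - u) • q := by
    have : (u - g (v - u) • p) + g (v - u) • q = u + g (v - u) • (q - p) := by
      rw [smul_sub]; abel
    rw [this, ← h1]; abel
  refine ⟨(u - g (v - u) • p, g (v - u)), hpos, rfl, mem_copySet'.2 ⟨p, hp, hu⟩,
    mem_copySet'.2 ⟨q, hq, hv⟩, fun j => ?_, fun j => ?_⟩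
  · rw [h2]
    unfold ActAt
    simp only [inner_sub_right, inner_smul_right]
    constructor
    · intro h
      have : g (v - u) * inner ℝ (a j) p = g (v - u) * b j := by linarith
      exact mul_left_cancel₀ hpos.ne' this
    · intro h
      rw [h]; ring
  · rw [h3]
    unfold ActAt
    have h4 : inner ℝ (a j) v = inner ℝ (a j) (u - g (v - u) • p) + g (v - u) * inner ℝ (a j) q := by
      conv_lhs => rw [hv]
      rw [inner_add_right, inner_smul_right]
    simp only
    rw [h4]
    constructor
    · intro h
      exact mul_left_cancel₀ hpos.ne' (add_left_cancel h)
    · intro h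
      rw [h]

theorem ChordSys.misses (H : ChordSys P a b g r n J J') {c c1 : E × ℝ} {u v : E}
    (hc : Chord P a b g J J' c u v) (h0 : 0 < c1.2) (h1 : c1.2 < c.2) :
    u ∉ copySet P c1 ∨ v ∉ copySet P c1 := by
  by_contra hcon
  push Not at hcon
  have := H.hcov u v c1 h0 hcon.1 hcon.2
  rw [← hc.eq] at this
  linarith

theorem ChordSys.g_small (H : ChordSys P a b g r n J J') (u : E) {ε : ℝ} (hε : 0 < ε) :
    ∃ δ > 0, ∀ v, dist v u < δ → g (v - u) < ε ∧ g (u - v) < ε := by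
  have h1 : Continuous fun v => g (v - u) := H.gcont.comp (by fun_prop)
  have h2 : Continuous fun v => g (u - v) := H.gcont.comp (by fun_prop)
  have e1 : ∀ᶠ v in 𝓝 u, g (v - u) < ε :=
    h1.continuousAt.eventually_lt_const (by simpa [H.g0] using hε)
  have e2 : ∀ᶠ v in 𝓝 u, g (u - v) < ε :=
    h2.continuousAt.eventually_lt_const (by simpa [H.g0] using hε)
  obtain ⟨δ, hδ, h⟩ := Metric.eventually_nhds_iff.1 (e1.and e2)
  exact ⟨δ, hδ, fun v hv => h hv⟩

theorem ChordSys.fit_u (H : ChordSys P a b g r n J J') {c0 : E × ℝ} (h0 : 0 < c0.2) {u : E}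
    (hu : u ∈ copySet P c0) (hact : ∀ j, ActAt a b c0 u j → j ∈ J) (T : Set E) (hT : IsClosed T)
    (huT : u ∉ T) : ∃ ε > 0, ∀ v, v ≠ u → dist v u < ε → ∀ c, Chord P a b g J J' c u v →
      copySet P c ⊆ copySet P c0 \ T := by
  obtain ⟨ε, hε, h⟩ := fit H.hPc H.hPeq h0 hu T hT huT
  obtain ⟨δ, hδ, h'⟩ := H.g_small u hε
  exact ⟨δ, hδ, fun v _ hd c hc => h c hc.pos (hc.eq ▸ (h' v hd).1) hc.hu
    fun j hj => (hc.au j).2 (hact j hj)⟩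

theorem ChordSys.fit_v (H : ChordSys P a b g r n J J') {c0 : E × ℝ} (h0 : 0 < c0.2) {v : E}
    (hv : v ∈ copySet P c0) (hact : ∀ j, ActAt a b c0 v j → j ∈ J') (T : Set E) (hT : IsClosed T)
    (hvT : v ∉ T) : ∃ ε > 0, ∀ u, u ≠ v → dist u v < ε → ∀ c, Chord P a b g J J' c u v →
      copySet P c ⊆ copySet P c0 \ T := by
  obtain ⟨ε, hε, h⟩ := fit H.hPc H.hPeq h0 hv T hT hvT
  obtain ⟨δ, hδ, h'⟩ := H.g_small v hε
  exact ⟨δ, hδ, fun u _ hd c hc => h c hc.pos (hc.eq ▸ (h' u hd).2) hc.hv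
    fun j hj => (hc.av j).2 (hact j hj)⟩

theorem ChordSys.act_near (H : ChordSys P a b g r n J J') {c : E × ℝ} (h0 : 0 < c.2) {z : E}
    (hz : z ∈ copySet P c) : ∃ ε > 0, ∀ z', dist z' z < ε → ∀ c' : E × ℝ, 0 < c'.2 →
      copySet P c' ⊆ copySet P c → z' ∈ copySet P c' → ∀ j, ActAt a b c z' j →
      ActAt a b c z j ∧ ActAt a b c' z' j := by
  have e : ∀ᶠ y in 𝓝 z, ∀ j, ActAt a b c y j → ActAt a b c z j := by
    rw [Filter.eventually_all]
    intro j
    by_cases hj : ActAt a b c z j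
    · exact Filter.Eventually.of_forall fun y h => hj
    · have hlt : inner ℝ (a j) z < inner ℝ (a j) c.1 + c.2 * b j :=
        lt_of_le_of_ne ((mem_copySet_iff H.hPeq h0).1 hz j) hj
      have : Continuous fun y : E => inner ℝ (a j) y := by fun_prop
      filter_upwards [this.continuousAt.eventually_lt_const hlt] with y hy hy'
      exact absurd hy' hy.ne
  obtain ⟨δ, hδ, h⟩ := Metric.eventually_nhds_iff.1 e
  refine ⟨δ, hδ, fun z' hd c' hc' hsub hz' j hj => ⟨h hd j hj, ?_⟩⟩
  obtain ⟨q, hq, hqe⟩ := mem_copySet'.1 (hsub hz')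
  have hqb : inner ℝ (a j) q = b j := by
    have h1 : inner ℝ (a j) z' = inner ℝ (a j) c.1 + c.2 * inner ℝ (a j) q := by
      rw [hqe, inner_add_right, inner_smul_right]
    unfold ActAt at hj
    rw [hj] at h1
    exact (mul_left_cancel₀ h0.ne' (add_left_cancel h1)).symm
  have h2 := (mem_copySet_iff H.hPeq h0).1
    (hsub (mem_copySet'.2 ⟨q, hq, rfl⟩ : c'.1 + c'.2 • q ∈ copySet P c')) j
  rw [inner_add_right, inner_smul_right, hqb] at h2
  have h3 := (mem_copySet_iff H.hPeq hc').1 hz' j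
  unfold ActAt at hj ⊢
  linarith

theorem ChordSys.near_u (H : ChordSys P a b g r n J J') {c : E × ℝ} {u v : E}
    (hc : Chord P a b g J J' c u v) : ∃ ε > 0, ∀ z, z ≠ u → dist z u < ε → r (z - u) = n →
      z ∈ copySet P c ∧ ∀ j, ActAt a b c z j → j ∈ J ∧ j ∈ J' := by
  obtain ⟨ε, hε, h⟩ := H.fit_u hc.pos hc.hu (fun j hj => (hc.au j).1 hj) ∅ isClosed_empty (by simp)
  obtain ⟨δ, hδ, h'⟩ := H.act_near hc.pos hc.hu
  refine ⟨min ε δ, lt_min hε hδ, fun z hz hd hr => ?_⟩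
  obtain ⟨c', hc'⟩ := H.place hz hr
  have hsub : copySet P c' ⊆ copySet P c :=
    (h z hz (hd.trans_le (min_le_left _ _)) c' hc').trans Set.sdiff_subset
  refine ⟨hsub hc'.hv, fun j hj => ?_⟩
  have := h' z (hd.trans_le (min_le_right _ _)) c' hc'.pos hsub hc'.hv j hj
  exact ⟨(hc.au j).1 this.1, (hc'.av j).1 this.2⟩

theorem ChordSys.near_v (H : ChordSys P a b g r n J J') {c : E × ℝ} {u v : E}
    (hc : Chord P a b g J J' c u v) : ∃ ε > 0, ∀ z, z ≠ v → dist z v < ε → r (v - z) = n →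
      z ∈ copySet P c ∧ ∀ j, ActAt a b c z j → j ∈ J ∧ j ∈ J' := by
  obtain ⟨ε, hε, h⟩ := H.fit_v hc.pos hc.hv (fun j hj => (hc.av j).1 hj) ∅ isClosed_empty (by simp)
  obtain ⟨δ, hδ, h'⟩ := H.act_near hc.pos hc.hv
  refine ⟨min ε δ, lt_min hε hδ, fun z hz hd hr => ?_⟩
  obtain ⟨c', hc'⟩ := H.place hz.symm hr
  have hsub : copySet P c' ⊆ copySet P c :=
    (h z hz (hd.trans_le (min_le_left _ _)) c' hc').trans Set.sdiff_subset
  refine ⟨hsub hc'.hu, fun j hj => ?_⟩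
  have := h' z (hd.trans_le (min_le_right _ _)) c' hc'.pos hsub hc'.hu j hj
  exact ⟨(hc'.au j).1 this.2, (hc.av j).1 this.1⟩

end sys

section games
variable {E : Type*} [NormedAddCommGroup E] [InnerProductSpace ℝ E]

theorem getD_ofFn_aux {E : Type*} [NormedAddCommGroup E] (m : ℕ → E × ℝ)
    (N i : ℕ) (h : i < N) :
    (List.ofFn fun j : Fin N => m j).getD i 0 = m i := by
  simp [h]

theorem rule_congr {P : Set E} {m m' : ℕ → E × ℝ} {i : ℕ} (h : ∀ j ≤ i, m j = m' j)
    (hr : Rule P m i) : Rule P m' i := by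
  unfold Rule at *
  rw [← h i le_rfl, ← h (i - 1) (by omega), ← h (i - 2) (by omega)]
  exact hr

theorem rule_odd {P : Set E} {m : ℕ → E × ℝ} {n : ℕ} :
    Rule P m (2 * n + 1) ↔ 0 < (m (2 * n + 1)).2 ∧ (m (2 * n + 1)).2 < (m (2 * n)).2 := by
  unfold Rule
  rw [if_pos (by omega)]
  simp

theorem rule_even {P : Set E} {m : ℕ → E × ℝ} {n : ℕ} :
    Rule P m (2 * n + 2) ↔ 0 < (m (2 * n + 2)).2 ∧
      copySet P (m (2 * n + 2)) ⊆ copySet P (m (2 * n)) \ copySet P (m (2 * n + 1)) := by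
  unfold Rule
  rw [if_neg (by omega)]
  simp

theorem rule_zero {P : Set E} {m : ℕ → E × ℝ} : Rule P m 0 ↔ 0 < (m 0).2 := by
  unfold Rule
  simp

/-- A countable target: player II wins. -/
theorem winII_of_countable {P : Set E} {p0 : E} (hp0 : p0 ∈ P) {A : Set E} (hA : A.Countable) :
    ∃ σ, WinningII P A σ := by
  have : ∃ e : ℕ → E, A ⊆ Set.range e := by
    rcases A.eq_empty_or_nonempty with h | h
    · exact ⟨fun _ => 0, by simp [h]⟩
    · obtain ⟨e, he⟩ := hA.exists_eq_range h
      exact ⟨e, he.subset⟩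
  obtain ⟨e, he⟩ := this
  refine ⟨fun l => (e ((l.length - 1) / 2) - ((l.getD (l.length - 1) 0).2 / 2) • p0,
    (l.getD (l.length - 1) 0).2 / 2), fun m hm => ?_⟩
  have hm' : ∀ n, m (2 * n + 1) = (e n - ((m (2 * n)).2 / 2) • p0, (m (2 * n)).2 / 2) := by
    intro n
    rw [hm n]
    simp only [List.length_ofFn, Nat.add_sub_cancel]
    rw [getD_ofFn_aux _ _ _ (by omega), Nat.mul_div_cancel_left _ (by norm_num)]
  constructor
  · intro n hr
    have h1 : 0 < (m (2 * n)).2 := (hr (2 * n) (by omega)).1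
    rw [rule_odd, hm']
    simp only
    constructor <;> linarith
  · intro hr
    rw [Set.eq_empty_iff_forall_notMem]
    rintro x ⟨hx, hxA⟩
    obtain ⟨n, rfl⟩ := he hxA
    have h2 := (rule_even.1 (hr (2 * n + 2))).2
    have h3 := Set.mem_iInter.1 hx (n + 1)
    refine (h2 h3).2 ?_
    rw [hm' n, mem_copySet']
    exact ⟨p0, hp0, by simp⟩

variable {P : Set E} {k : ℕ} {a : Fin k → E} {b : Fin k → ℝ} {g : E → ℝ} {r : E → ℕ}
    {n : ℕ} {J J' : Set (Fin k)}

theorem winI_of_good (H : ChordSys P a b g r n J J') {A F G : Set E} (hF : IsClosed F)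
    (hFA : F ⊆ A) (hGF : G ⊆ F) (hG : G.Nonempty)
    (h : ∀ u ∈ G, ∀ ε > 0, (∃ v ∈ G, v ≠ u ∧ dist v u < ε ∧ r (v - u) = n) ∧
      (∃ v ∈ G, v ≠ u ∧ dist v u < ε ∧ r (u - v) = n)) : ∃ σ, WinningI P A σ := by
  classical
  let Inv : E × ℝ → Prop := fun c => ∃ u ∈ G, ∃ v ∈ G, Chord P a b g J J' c u v
  have hstart : ∃ c, Inv c := by
    obtain ⟨u, hu⟩ := hG
    obtain ⟨⟨v, hv, hvu, -, hr⟩, -⟩ := h u hu 1 one_pos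
    obtain ⟨c, hc⟩ := H.place hvu hr
    exact ⟨c, u, hu, v, hv, hc⟩
  have hstep : ∀ c c1 : E × ℝ, ∃ c2, Inv c → 0 < c1.2 → c1.2 < c.2 →
      Inv c2 ∧ copySet P c2 ⊆ copySet P c \ copySet P c1 := by
    intro c c1
    by_cases hyp : Inv c ∧ 0 < c1.2 ∧ c1.2 < c.2
    · obtain ⟨⟨u, hu, v, hv, hc⟩, h0, h1⟩ := hyp
      have hcl : IsClosed (copySet P c1) := (isCompact_copySet H.hPc c1).isClosed
      rcases H.misses hc h0 h1 with hm | hm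
      · obtain ⟨ε, hε, hf⟩ := H.fit_u hc.pos hc.hu (fun j hj => (hc.au j).1 hj) _ hcl hm
        obtain ⟨⟨z, hz, hzu, hd, hr⟩, -⟩ := h u hu ε hε
        obtain ⟨c2, hc2⟩ := H.place hzu hr
        exact ⟨c2, fun _ _ _ => ⟨⟨u, hu, z, hz, hc2⟩, hf z hzu hd c2 hc2⟩⟩
      · obtain ⟨ε, hε, hf⟩ := H.fit_v hc.pos hc.hv (fun j hj => (hc.av j).1 hj) _ hcl hm
        obtain ⟨-, ⟨z, hz, hzv, hd, hr⟩⟩ := h v hv ε hε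
        obtain ⟨c2, hc2⟩ := H.place hzv.symm hr
        exact ⟨c2, fun _ _ _ => ⟨⟨z, hz, v, hv, hc2⟩, hf z hzv hd c2 hc2⟩⟩
    · exact ⟨c, fun h1 h2 h3 => absurd ⟨h1, h2, h3⟩ hyp⟩
  obtain ⟨c0, hc0⟩ := hstart
  choose nx hnx using hstep
  refine ⟨fun l => if l.length = 0 then c0 else
    nx (l.getD (l.length - 2) 0) (l.getD (l.length - 1) 0), fun m hm => ?_⟩
  have m0 : m 0 = c0 := by simpa using hm 0
  have ms : ∀ i, m (2 * i + 2) = nx (m (2 * i)) (m (2 * i + 1)) := by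
    intro i
    have := hm (i + 1)
    rw [show 2 * (i + 1) = 2 * i + 2 by ring] at this
    rw [this]
    simp only [List.length_ofFn]
    rw [if_neg (by omega), getD_ofFn_aux _ _ _ (by omega), getD_ofFn_aux _ _ _ (by omega)]
    rfl
  have main : ∀ i, (∀ j < 2 * i, Rule P m j) → Inv (m (2 * i)) := by
    intro i
    induction i with
    | zero => intro _; simpa [m0] using hc0
    | succ i ih =>
      intro hr
      have h1 := ih fun j hj => hr j (by omega)
      have h2 := rule_odd.1 (hr (2 * i + 1) (by omega))
      rw [show 2 * (i + 1) = 2 * i + 2 by ring, ms]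
      exact (hnx _ _ h1 h2.1 h2.2).1
  have pos : ∀ c, Inv c → 0 < c.2 := by
    rintro c ⟨u, _, v, _, hc⟩
    exact hc.pos
  refine ⟨fun i hr => ?_, fun hr => ?_⟩
  · cases i with
    | zero => exact rule_zero.2 (pos _ (main 0 (by simp)))
    | succ i =>
      refine rule_even.2 ⟨pos _ (main (i + 1) hr), ?_⟩
      have h1 := main i fun j hj => hr j (by omega)
      have h2 := rule_odd.1 (hr (2 * i + 1) (by omega))
      rw [ms]
      exact (hnx _ _ h1 h2.1 h2.2).2
  · have hne : (⋂ i, copySet P (m (2 * i)) ∩ F).Nonempty := by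
      refine IsCompact.nonempty_iInter_of_sequence_nonempty_isCompact_isClosed _ ?_ ?_ ?_ ?_
      · intro i
        exact Set.inter_subset_inter_left _ fun x hx => ((rule_even.1 (hr (2 * i + 2))).2 hx).1
      · intro i
        obtain ⟨u, hu, v, hv, hc⟩ := main i fun j _ => hr j
        exact ⟨u, hc.hu, hGF hu⟩
      · exact (isCompact_copySet H.hPc _).inter_right hF
      · intro i
        exact (isCompact_copySet H.hPc _).isClosed.inter hF
    obtain ⟨x, hx⟩ := hne
    rw [Set.mem_iInter] at hx
    exact ⟨x, Set.mem_iInter.2 fun i => (hx i).1, hFA (hx 0).2⟩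

end games

section gameI
variable {E : Type*} [NormedAddCommGroup E] [InnerProductSpace ℝ E]

theorem diam_copySet (P : Set E) (c : E × ℝ) (hc : 0 < c.2) :
    Metric.diam (copySet P c) = c.2 * Metric.diam P := by
  unfold copySet
  rw [show Metric.diam (c.1 +ᵥ c.2 • P) = Metric.diam (c.2 • P) from
    (IsometryEquiv.constVAdd (X := E) c.1).diam_image _, diam_smul₀, Real.norm_of_nonneg hc.le]

theorem perfect_of_winI [SecondCountableTopology E] {P : Set E} (hPc : IsCompact P) {k : ℕ}
    {a : Fin k → E} {b : Fin k → ℝ}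
    (hPeq : ∀ z, z ∈ P ↔ ∀ i, inner ℝ (a i) z ≤ b i) {p0 : E} (hp0 : p0 ∈ P) {A : Set E}
    {σ : Strategy E} (hσ : WinningI P A σ) : ContainsPerfectSet A := by
  classical
  let half : E × ℝ → E × ℝ := fun c => (c.1 + (c.2 / 2) • p0, c.2 / 2)
  let f : (ℕ → Bool) → List (E × ℝ) → E × ℝ := fun x l =>
    if l.length % 2 = 0 then σ l else
      if l.length % 4 = 3 ∧ x (l.length / 4) = true then
        σ (l ++ [half (l.getD (l.length - 1) 0)])
      else half (l.getD (l.length - 1) 0)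
  choose run hrun using fun x => exists_play (f x)
  have hfol : ∀ x, FollowsI σ (run x) := by
    intro x i
    rw [hrun x (2 * i)]
    simp only [f, List.length_ofFn]
    rw [if_pos (by omega)]
  have hhalf : ∀ x i, (i % 2 = 0 ∨ x (i / 2) = false) →
      run x (2 * i + 1) = half (run x (2 * i)) := by
    intro x i hi
    rw [hrun x (2 * i + 1)]
    simp only [f, List.length_ofFn]
    rw [if_neg (by omega), if_neg, getD_ofFn_aux _ _ _ (by omega)]
    · rfl
    · rintro ⟨h1, h2⟩
      rw [show (2 * i + 1) / 4 = i / 2 by omega] at h2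
      rcases hi with hi | hi
      · omega
      · rw [hi] at h2; exact absurd h2 (by simp)
  have hagree : ∀ (N : ℕ) (x y : ℕ → Bool), (∀ i < N, x i = y i) →
      ∀ i ≤ 4 * N + 2, run x i = run y i := by
    intro N x y hxy i
    induction i using Nat.strong_induction_on with
    | _ i ih =>
      intro hi
      have hl : (List.ofFn fun j : Fin i => run x j) = List.ofFn fun j : Fin i => run y j := by
        congr 1
        funext j
        exact ih j j.2 (by omega)
      rw [hrun x i, hrun y i, hl]
      simp only [f, List.length_ofFn]
      by_cases h4 : i % 4 = 3
      · rw [hxy (i / 4) (by omega)]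
      · simp [h4]
  have halt : ∀ (x y : ℕ → Bool) (j : ℕ), (∀ i < j, x i = y i) → x j = true → y j = false →
      run x (4 * j + 3) = run y (4 * j + 4) := by
    intro x y j hxy hx hy
    have hag := hagree j x y hxy
    have h1 := hhalf y (2 * j + 1) (Or.inr (by rw [show (2 * j + 1) / 2 = j by omega]; exact hy))
    rw [hrun x (4 * j + 3), hrun y (4 * j + 4)]
    simp only [f, List.length_ofFn]
    rw [if_neg (by omega), if_pos ⟨by omega, by rw [show (4 * j + 3) / 4 = j by omega]; exact hx⟩,
      if_pos (by omega), getD_ofFn_aux _ _ _ (by omega)]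
    congr 1
    rw [List.ofFn_succ' (n := 4 * j + 3), List.concat_eq_append]
    congr 1
    · congr 1
      funext i
      exact hag i (by have := i.2; omega)
    · simp only [Fin.val_last]
      rw [show 4 * j + 3 - 1 = 4 * j + 2 by omega, hag _ le_rfl]
      rw [show 2 * (2 * j + 1) + 1 = 4 * j + 3 by ring, show 2 * (2 * j + 1) = 4 * j + 2 by ring] at h1
      rw [h1]
  have hhr : ∀ x i, (i % 2 = 0 ∨ x (i / 2) = false) → Rule P (run x) (2 * i) →
      Rule P (run x) (2 * i + 1) := by
    intro x i hi hr
    have := hr.1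
    rw [rule_odd, hhalf x i hi]
    simp only [half]
    constructor <;> linarith
  have hshr : ∀ x i, (i % 2 = 0 ∨ x (i / 2) = false) → Rule P (run x) (2 * i) →
      Rule P (run x) (2 * i + 2) → (run x (2 * i + 2)).2 < (run x (2 * i)).2 / 2 := by
    intro x i hi h1 h2
    have h3 := rule_even.1 h2
    rw [hhalf x i hi] at h3
    exact shrink hPc hPeq hp0 h1.1 h3.1 h3.2
  have hrule : ∀ i x, Rule P (run x) i := by
    intro i
    induction i using Nat.strong_induction_on with
    | _ i ih =>
      intro x
      obtain ⟨t, rfl | rfl⟩ : ∃ t, i = 2 * t ∨ i = 2 * t + 1 := ⟨i / 2, by omega⟩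
      · exact (hσ _ (hfol x)).1 t fun j hj => ih j hj x
      · by_cases hc : t % 2 = 0 ∨ x (t / 2) = false
        · exact hhr x t hc (ih _ (by omega) x)
        · push Not at hc
          obtain ⟨j, rfl⟩ : ∃ j, t = 2 * j + 1 := ⟨t / 2, by omega⟩
          have hx : x j = true := by
            have := hc.2
            rw [show (2 * j + 1) / 2 = j by omega] at this
            simpa using this
          let y := Function.update x j false
          have hy : y j = false := by simp [y]
          have hxy : ∀ i < j, x i = y i := fun i hi => by
            simp [y, Function.update_of_ne hi.ne]
          have e1 := halt x y j hxy hx hy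
          have e2 := hagree j x y hxy (4 * j + 2) le_rfl
          have hcy : (2 * j + 1) % 2 = 0 ∨ y ((2 * j + 1) / 2) = false :=
            Or.inr (by rw [show (2 * j + 1) / 2 = j by omega]; exact hy)
          have r0 : ∀ i < 2 * (2 * j + 1) + 1, Rule P (run y) i := fun i hi => ih i hi y
          have r1 := hhr y (2 * j + 1) hcy (r0 _ (by omega))
          have r2 : Rule P (run y) (2 * (2 * j + 1) + 2) :=
            (hσ _ (hfol y)).1 (2 * j + 2) fun i hi => by
              rcases Nat.lt_succ_iff_lt_or_eq.1 (show i < 2 * (2 * j + 1) + 1 + 1 by omega) with h | h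
              · exact r0 i h
              · rw [h]; exact r1
          have r3 := hshr y (2 * j + 1) hcy (r0 _ (by omega)) r2
          have r4 := (r0 (2 * (2 * j + 1)) (by omega)).1
          rw [rule_odd]
          rw [show 2 * (2 * j + 1) + 1 = 4 * j + 3 by ring, show 2 * (2 * j + 1) = 4 * j + 2 by ring,
            e1, e2]
          rw [show 2 * (2 * j + 1) + 2 = 4 * j + 4 by ring] at r2 r3
          rw [show 2 * (2 * j + 1) = 4 * j + 2 by ring] at r3 r4
          exact ⟨r2.1, by linarith⟩
  choose F hF using fun x => (hσ _ (hfol x)).2 fun i => hrule i x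
  have hFm : ∀ x i, F x ∈ copySet P (run x (2 * i)) := fun x i => Set.mem_iInter.1 (hF x).1 i
  -- injectivity
  have hne : ∀ (x y : ℕ → Bool) (j : ℕ), (∀ i < j, x i = y i) → x j = true → y j = false →
      F x ≠ F y := by
    intro x y j hxy hx hy he
    have h1 := rule_even.1 (hrule (2 * (2 * j + 1) + 2) x)
    have h2 := (h1.2 (hFm x (2 * j + 2))).2
    rw [show 2 * (2 * j + 1) + 1 = 4 * j + 3 by ring, halt x y j hxy hx hy, he] at h2
    have h3 := hFm y (2 * j + 2)
    rw [show 2 * (2 * j + 2) = 4 * j + 4 by ring] at h3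
    exact h2 h3
  have hinj : Function.Injective F := by
    intro x y he
    by_contra hxy
    have hex : ∃ j, x j ≠ y j := Function.ne_iff.1 hxy
    have hlt : ∀ i < Nat.find hex, x i = y i := fun i hi => by
      simpa using Nat.find_min hex hi
    have hj := Nat.find_spec hex
    cases hx : x (Nat.find hex) <;> cases hy : y (Nat.find hex)
    · rw [hx, hy] at hj; exact hj rfl
    · exact hne y x _ (fun i hi => (hlt i hi).symm) hy hx he.symm
    · exact hne x y _ hlt hx hy he
    · rw [hx, hy] at hj; exact hj rfl
  -- diameters
  let D : ℝ := Metric.diam (copySet P (σ []))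
  have hdiam : ∀ x i, Metric.diam (copySet P (run x (4 * i))) ≤ D / 2 ^ i := by
    intro x i
    induction i with
    | zero =>
      have : run x 0 = σ [] := by simpa using hfol x 0
      simp [this, D]
    | succ i ih =>
      have s1 : copySet P (run x (4 * (i + 1))) ⊆ copySet P (run x (4 * i + 2)) := fun z hz =>
        ((rule_even.1 (hrule (2 * (2 * i + 1) + 2) x)).2
          (by rw [show 2 * (2 * i + 1) + 2 = 4 * (i + 1) by ring]; exact hz)).1 |> fun h => by
          rwa [show 2 * (2 * i + 1) = 4 * i + 2 by ring] at h
      have s2 := Metric.diam_mono s1 (isCompact_copySet hPc _).isBounded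
      have s3 := hshr x (2 * i) (Or.inl (by omega)) (hrule _ x) (hrule _ x)
      rw [show 2 * (2 * i) = 4 * i by ring] at s3
      rw [diam_copySet P _ (hrule (4 * i + 2) x).1] at s2
      rw [diam_copySet P _ (hrule (4 * i) x).1] at ih
      have s4 : (run x (4 * i + 2)).2 * Metric.diam P ≤ (run x (4 * i)).2 / 2 * Metric.diam P :=
        mul_le_mul_of_nonneg_right s3.le Metric.diam_nonneg
      rw [pow_succ, ← div_div]
      linarith
  have hcont : Continuous F := by
    rw [continuous_iff_continuousAt]
    intro x
    rw [ContinuousAt, Metric.tendsto_nhds]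
    intro ε hε
    have ht : Tendsto (fun i : ℕ => D / 2 ^ i) atTop (𝓝 0) := by
      have := (tendsto_pow_atTop_nhds_zero_of_lt_one (r := (1 / 2 : ℝ)) (by norm_num)
        (by norm_num)).const_mul D
      simpa [div_eq_mul_inv] using this
    obtain ⟨N, hN⟩ := (ht.eventually_lt_const hε).exists
    have hnb : ∀ᶠ y in 𝓝 x, ∀ i ∈ Set.Iio N, y i = x i := by
      rw [Filter.eventually_all_finite (Set.finite_Iio N)]
      intro i _
      have hc : Continuous fun y : ℕ → Bool => y i := continuous_apply i
      exact hc.continuousAt.eventually ((isOpen_discrete {x i}).eventually_mem rfl)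
    filter_upwards [hnb] with y hy
    have e := hagree N y x hy (4 * N) (by omega)
    have h1 := hFm y (2 * N)
    have h2 := hFm x (2 * N)
    rw [show 2 * (2 * N) = 4 * N by ring] at h1 h2
    rw [e] at h1
    exact (Metric.dist_le_diam_of_mem (isCompact_copySet hPc _).isBounded h1 h2).trans_lt
      ((hdiam x N).trans_lt hN)
  have hclosed : IsClosed (Set.range F) := (isCompact_range hcont).isClosed
  have hunc : ¬ (Set.range F).Countable := by
    intro hc
    have : Countable (ℕ → Bool) := by
      have h1 : Countable (Set.range F) := hc.to_subtype
      exact Countable.of_equiv _ (Equiv.ofInjective F hinj).symm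
    obtain ⟨e, he⟩ := this.exists_injective_nat
    refine Function.cantor_injective (fun s : Set ℕ => e fun i => decide (i ∈ s)) ?_
    intro s t hst
    ext i
    have := congrFun (he hst) i
    simpa using this
  obtain ⟨C, hC, hCne, hCF⟩ := exists_perfect_nonempty_of_isClosed_of_not_countable hclosed hunc
  refine ⟨C, fun z hz => ?_, hC, hCne⟩
  obtain ⟨x, rfl⟩ := hCF hz
  exact (hF x).2

end gameI

section gameII
variable {E : Type*} [NormedAddCommGroup E] [InnerProductSpace ℝ E]
variable {P : Set E} {k : ℕ} {a : Fin k → E} {b : Fin k → ℝ} {g : E → ℝ} {r : E → ℕ}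
    {n : ℕ} {J J' : Set (Fin k)}

/-- points of a copy that survive and at which the copy has only common active constraints -/
def Surv (P : Set E) (a : Fin k → E) (b : Fin k → ℝ) (J J' : Set (Fin k)) (c c1 : E × ℝ) :
    Set E :=
  {z | z ∈ copySet P c ∧ (∀ j, ActAt a b c z j → j ∈ J ∧ j ∈ J') ∧ z ∉ copySet P c1}

theorem local_cover [SecondCountableTopology E] (H : ChordSys P a b g r n J J')
    (husc : ∀ w, ∀ᶠ w' in 𝓝 w, r w' ≤ r w) {Y W : Set E}
    (h1 : ∀ u ∈ Y, ∀ v ∈ Y, u ≠ v → n ≤ r (v - u))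
    (h2 : ∀ Y' ⊆ Y, ¬ Y'.Countable → ∃ u ∈ Y', ∃ v ∈ Y', u ≠ v ∧ r (v - u) = n)
    (Leg : E × ℝ → Prop) (rep : E × ℝ → E × ℝ)
    (hrep : ∀ c, Leg c → 0 < (rep c).2 ∧ (rep c).2 < c.2)
    (hleg : ∀ u ∈ W, ∃ ε > 0, ∀ v, v ≠ u → dist v u < ε → ∀ c, Chord P a b g J J' c u v → Leg c) :
    ∃ C : Set (E × ℝ), C.Countable ∧ (∀ c ∈ C, Leg c) ∧
      ((Y ∩ W) \ ⋃ c ∈ C, Surv P a b J J' c (rep c)).Countable := by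
  classical
  let Small : Set E → Prop := fun B => ∃ C : Set (E × ℝ), C.Countable ∧ (∀ c ∈ C, Leg c) ∧
      (B \ ⋃ c ∈ C, Surv P a b J J' c (rep c)).Countable
  have hmono : ∀ s t, s ⊆ t → Small t → Small s := by
    rintro s t hst ⟨C, hC, hl, hc⟩
    exact ⟨C, hC, hl, hc.mono (Set.sdiff_subset_sdiff_left hst)⟩
  have hunion : ∀ S : Set (Set E), S.Countable → (∀ s ∈ S, Small s) → Small (⋃₀ S) := by
    intro S hS hs
    choose! C hC hl hc using hs
    refine ⟨⋃ s ∈ S, C s, hS.biUnion hC, ?_, ?_⟩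
    · intro c hcm
      simp only [Set.mem_iUnion] at hcm
      obtain ⟨s, hsS, hcs⟩ := hcm
      exact hl s hsS c hcs
    · refine (hS.biUnion hc).mono ?_
      rintro z ⟨⟨s, hsS, hz⟩, hn⟩
      simp only [Set.mem_iUnion] at hn ⊢
      refine ⟨s, hsS, hz, ?_⟩
      simp only [Set.mem_iUnion]
      rintro ⟨c, hcs, hzc⟩
      exact hn ⟨c, ⟨s, hsS, hcs⟩, hzc⟩
  have hcount : ∀ s : Set E, s.Countable → Small s := fun s hs =>
    ⟨∅, Set.countable_empty, by simp, hs.mono Set.sdiff_subset⟩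
  by_contra hns
  have hns' : ¬ Small (Y ∩ W) := hns
  obtain ⟨G, hGY, hGs, hG⟩ := good_set r husc Small hmono hunion hcount n (Y ∩ W) hns'
    (fun u hu v hv => h1 u hu.1 v hv.1) (fun Y' hY' => h2 Y' (hY'.trans Set.inter_subset_left))
  have hne : ∀ s, ¬ Small s → s.Nonempty := by
    intro s hs
    by_contra h
    rw [Set.not_nonempty_iff_eq_empty] at h
    exact hs (hcount s (by rw [h]; exact Set.countable_empty))
  obtain ⟨u, hu⟩ := hne G hGs
  obtain ⟨ε, hε, hl⟩ := hleg u (hGY hu).2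
  obtain ⟨v, hv, hvu, hd, hr⟩ := hne _ (hG u hu ε hε).1
  obtain ⟨c, hc⟩ := H.place hvu hr
  have hcl := hl v hvu hd c hc
  have hsm : ∀ s, s ⊆ Surv P a b J J' c (rep c) → Small s := by
    intro s hs
    refine ⟨{c}, Set.countable_singleton c, by simpa using hcl, ?_⟩
    simp only [Set.mem_singleton_iff, Set.iUnion_iUnion_eq_left]
    rw [Set.sdiff_eq_empty.2 hs]
    exact Set.countable_empty
  have hopen : IsOpen (copySet P (rep c))ᶜ := (isCompact_copySet H.hPc _).isClosed.isOpen_compl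
  rcases H.misses hc (hrep c hcl).1 (hrep c hcl).2 with hm | hm
  · obtain ⟨δ, hδ, hn⟩ := H.near_u hc
    obtain ⟨η, hη, hb⟩ := Metric.isOpen_iff.1 hopen u hm
    refine (hG u hu (min δ η) (lt_min hδ hη)).1 (hsm _ ?_)
    rintro z ⟨-, hz, hzd, hzr⟩
    have := hn z hz (hzd.trans_le (min_le_left _ _)) hzr
    exact ⟨this.1, this.2, hb (hzd.trans_le (min_le_right _ _))⟩
  · obtain ⟨δ, hδ, hn⟩ := H.near_v hc
    obtain ⟨η, hη, hb⟩ := Metric.isOpen_iff.1 hopen v hm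
    refine (hG v hv (min δ η) (lt_min hδ hη)).2 (hsm _ ?_)
    rintro z ⟨-, hz, hzd, hzr⟩
    have := hn z hz (hzd.trans_le (min_le_left _ _)) hzr
    exact ⟨this.1, this.2, hb (hzd.trans_le (min_le_right _ _))⟩

theorem countable_of_winII [SecondCountableTopology E] (H : ChordSys P a b g r n J J')
    (husc : ∀ w, ∀ᶠ w' in 𝓝 w, r w' ≤ r w) {A Y : Set E} (hYA : Y ⊆ A)
    (h1 : ∀ u ∈ Y, ∀ v ∈ Y, u ≠ v → n ≤ r (v - u))
    (h2 : ∀ Y' ⊆ Y, ¬ Y'.Countable → ∃ u ∈ Y', ∃ v ∈ Y', u ≠ v ∧ r (v - u) = n)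
    {τ : Strategy E} (hτ : WinningII P A τ) : Y.Countable := by
  classical
  let f : (ℕ → E × ℝ) → List (E × ℝ) → E × ℝ := fun t l =>
    if l.length % 2 = 0 then t (l.length / 2) else τ l
  choose run hrun using fun t => exists_play (f t)
  have hev : ∀ t i, run t (2 * i) = t i := by
    intro t i
    rw [hrun]
    simp [f]
  have hfol : ∀ t, FollowsII τ (run t) := by
    intro t i
    rw [hrun t (2 * i + 1)]
    simp only [f, List.length_ofFn]
    rw [if_neg (by omega)]
  have hagree : ∀ (N : ℕ) (x y : ℕ → E × ℝ), (∀ i < N, x i = y i) →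
      ∀ i < 2 * N, run x i = run y i := by
    intro N x y hxy i
    induction i using Nat.strong_induction_on with
    | _ i ih =>
      intro hi
      have hl : (List.ofFn fun j : Fin i => run x j) = List.ofFn fun j : Fin i => run y j := by
        congr 1
        funext j
        exact ih j j.2 (by omega)
      rw [hrun x i, hrun y i, hl]
      simp only [f, List.length_ofFn]
      rw [hxy (i / 2) (by omega)]
  have hupd : ∀ (t : ℕ → E × ℝ) i c, ∀ j < i, t j = Function.update t i c j := by
    intro t i c j hj
    rw [Function.update_of_ne hj.ne]
  let Legal : (ℕ → E × ℝ) → ℕ → Prop := fun t i => ∀ j < 2 * i, Rule P (run t) j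
  let Reg : (ℕ → E × ℝ) → ℕ → Set E := fun t i =>
    {z | ∀ j, i = j + 1 → z ∈ Surv P a b J J' (t j) (run t (2 * j + 1))}
  have hRsucc : ∀ t i z, z ∈ Reg t (i + 1) ↔ z ∈ Surv P a b J J' (t i) (run t (2 * i + 1)) := by
    intro t i z
    constructor
    · intro h; exact h i rfl
    · intro h j hj
      obtain rfl : i = j := by omega
      exact h
  have hleg : ∀ t i, Legal t i → ∀ u ∈ Reg t i, ∃ ε > 0, ∀ v, v ≠ u → dist v u < ε →
      ∀ c, Chord P a b g J J' c u v → Legal (Function.update t i c) (i + 1) := by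
    intro t i hl u hu
    have key : ∀ c, Rule P (run (Function.update t i c)) (2 * i) →
        Legal (Function.update t i c) (i + 1) := by
      intro c hc
      have hlow : ∀ j < 2 * i + 1, Rule P (run (Function.update t i c)) j := by
        intro j hj
        rcases Nat.lt_succ_iff_lt_or_eq.1 hj with h | h
        · exact rule_congr (fun j' hj' => hagree i _ _ (hupd t i c) j' (by omega)) (hl j h)
        · rw [h]; exact hc
      intro j hj
      rcases Nat.lt_succ_iff_lt_or_eq.1 (show j < 2 * i + 1 + 1 by omega) with h | h
      · exact hlow j h
      · rw [h]; exact (hτ _ (hfol _)).1 i hlow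
    cases i with
    | zero =>
      refine ⟨1, one_pos, fun v _ _ c hc => key c ?_⟩
      rw [Nat.mul_zero, rule_zero]
      have := hev (Function.update t 0 c) 0
      rw [Nat.mul_zero] at this
      rw [this]
      simpa using hc.pos
    | succ i =>
      rw [hRsucc] at hu
      have hp := (hl (2 * i) (by omega)).1
      rw [hev] at hp
      obtain ⟨ε, hε, hf⟩ := H.fit_u hp hu.1 (fun j hj => (hu.2.1 j hj).1) _
        (isCompact_copySet H.hPc (run t (2 * i + 1))).isClosed hu.2.2
      refine ⟨ε, hε, fun v hv hd c hc => key c ?_⟩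
      have e0 := hev (Function.update t (i + 1) c) (i + 1)
      rw [Function.update_self, show 2 * (i + 1) = 2 * i + 2 by ring] at e0
      have e1 := hagree (i + 1) _ _ (hupd t (i + 1) c)
      rw [show 2 * (i + 1) = 2 * i + 2 by ring, rule_even, e0, ← e1 _ (by omega),
        ← e1 _ (by omega), hev]
      exact ⟨hc.pos, hf v hv hd c hc⟩
  have hcov : ∀ t i, ∃ C : Set (E × ℝ), C.Countable ∧ (Legal t i →
      (∀ c ∈ C, Legal (Function.update t i c) (i + 1)) ∧
      ((Y ∩ Reg t i) \ ⋃ c ∈ C, Reg (Function.update t i c) (i + 1)).Countable) := by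
    intro t i
    by_cases hl : Legal t i
    · obtain ⟨C, hC, hC1, hC2⟩ := local_cover H husc (W := Reg t i) h1 h2
        (fun c => Legal (Function.update t i c) (i + 1))
        (fun c => run (Function.update t i c) (2 * i + 1)) (by
          intro c hc
          have := rule_odd.1 (hc (2 * i + 1) (by omega))
          rw [hev, Function.update_self] at this
          exact this) (hleg t i hl)
      refine ⟨C, hC, fun _ => ⟨hC1, hC2.mono ?_⟩⟩
      rintro z ⟨hz, hn⟩
      refine ⟨hz, fun hz' => hn ?_⟩
      simp only [Set.mem_iUnion] at hz' ⊢
      obtain ⟨c, hc, hzc⟩ := hz'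
      exact ⟨c, hc, (hRsucc _ _ _).2 (by rwa [Function.update_self])⟩
    · exact ⟨∅, Set.countable_empty, fun h => absurd h hl⟩
  choose C hC hC' using hcov
  let t0 : ℕ → E × ℝ := fun _ => 0
  let T : ℕ → Set (ℕ → E × ℝ) := fun i => Nat.rec {t0}
    (fun i S => ⋃ t ∈ S, (fun c => Function.update t i c) '' C t i) i
  have hTs : ∀ i, T (i + 1) = ⋃ t ∈ T i, (fun c => Function.update t i c) '' C t i := fun i => rfl
  have hTc : ∀ i, (T i).Countable := by
    intro i
    induction i with
    | zero => exact Set.countable_singleton t0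
    | succ i ih =>
      rw [hTs]
      exact ih.biUnion fun t _ => (hC t i).image _
  have hTl : ∀ i, ∀ t ∈ T i, Legal t i := by
    intro i
    induction i with
    | zero => intro t _ j hj; omega
    | succ i ih =>
      intro t ht
      rw [hTs] at ht
      simp only [Set.mem_iUnion] at ht
      obtain ⟨s, hs, c, hc, rfl⟩ := ht
      exact (hC' s i (ih s hs)).1 c hc
  let X : Set E := ⋃ i, ⋃ t ∈ T i, (Y ∩ Reg t i) \ ⋃ c ∈ C t i, Reg (Function.update t i c) (i + 1)
  have hX : X.Countable := Set.countable_iUnion fun i => (hTc i).biUnion fun t ht =>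
    (hC' t i (hTl i t ht)).2
  by_contra hY
  have hex : ∃ x ∈ Y, x ∉ X := by
    by_contra h
    push Not at h
    exact hY (hX.mono h)
  obtain ⟨x, hxY, hxX⟩ := hex
  have hstep : ∀ i t, ∃ t', (t ∈ T i ∧ x ∈ Reg t i) →
      (t' ∈ T (i + 1) ∧ x ∈ Reg t' (i + 1) ∧ ∃ c, t' = Function.update t i c) := by
    intro i t
    rcases Classical.em (t ∈ T i ∧ x ∈ Reg t i) with hyp | hyp
    · have : x ∈ ⋃ c ∈ C t i, Reg (Function.update t i c) (i + 1) := by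
        by_contra hn
        exact hxX (Set.mem_iUnion.2 ⟨i, Set.mem_iUnion₂.2 ⟨t, hyp.1, ⟨hxY, hyp.2⟩, hn⟩⟩)
      obtain ⟨c, hc, hxc⟩ := Set.mem_iUnion₂.1 this
      refine ⟨Function.update t i c, fun _ => ⟨?_, hxc, c, rfl⟩⟩
      rw [hTs]
      exact Set.mem_iUnion₂.2 ⟨t, hyp.1, c, hc, rfl⟩
    · exact ⟨t, fun h => absurd h hyp⟩
  choose nx hnx using hstep
  let s : ℕ → ℕ → E × ℝ := fun i => Nat.rec t0 (fun i t => nx i t) i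
  have hs : ∀ i, s i ∈ T i ∧ x ∈ Reg (s i) i := by
    intro i
    induction i with
    | zero => exact ⟨rfl, fun j hj => by omega⟩
    | succ i ih => exact ⟨(hnx i _ ih).1, (hnx i _ ih).2.1⟩
  have hss : ∀ i j, j < i → s (i + 1) j = s i j := by
    intro i j hj
    obtain ⟨c, hc⟩ := (hnx i _ (hs i)).2.2
    have : s (i + 1) = Function.update (s i) i c := hc
    rw [this, Function.update_of_ne hj.ne]
  let t : ℕ → E × ℝ := fun i => s (i + 1) i
  have ht : ∀ i j, j < i → s i j = t j := by
    intro i j hj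
    induction i with
    | zero => omega
    | succ i ih =>
      rcases Nat.lt_succ_iff_lt_or_eq.1 hj with h | h
      · rw [hss i j h, ih h]
      · rw [h]
  have hrule : ∀ i, Rule P (run t) i := by
    intro i
    exact rule_congr (fun j hj => hagree (i + 1) _ _ (ht (i + 1)) j (by omega))
      (hTl (i + 1) _ (hs (i + 1)).1 i (by omega))
  have hemp := (hτ _ (hfol t)).2 hrule
  rw [Set.eq_empty_iff_forall_notMem] at hemp
  refine hemp x ⟨Set.mem_iInter.2 fun i => ?_, hYA hxY⟩
  rw [hev]
  exact ((hRsucc _ _ _).1 (hs (i + 1)).2).1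

end gameII

theorem uncountable_of_perfect {E : Type*} [NormedAddCommGroup E] [CompleteSpace E] {F : Set E}
    (hF : Perfect F) (hne : F.Nonempty) : ¬ F.Countable := by
  intro hc
  obtain ⟨f, hfF, -, hinj⟩ := hF.exists_nat_bool_injection hne
  have hcr : (Set.range f).Countable := hc.mono hfF
  have : Countable (ℕ → Bool) := by
    have h1 : Countable (Set.range f) := hcr.to_subtype
    exact Countable.of_equiv _ (Equiv.ofInjective f hinj).symm
  obtain ⟨e, he⟩ := this.exists_injective_nat
  classical
  refine Function.cantor_injective (fun s : Set ℕ => e fun i => decide (i ∈ s)) ?_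
  intro s t hst
  have := he hst
  ext i
  have := congrFun this i
  simpa using this

/-- **Theorem (polytope case).** Let `d ≥ 1` and let `P ⊆ ℝ^d` be a compact convex
`d`-polytope.  Then for every target set `A ⊆ ℝ^d` the no-β McMullen game `G_P(A)` is
equivalent to the perfect set game: player I has a winning strategy iff `A` contains a
perfect set, and player II has a winning strategy iff `A` is countable. -/
theorem noBeta_mcMullen_polytope (d : ℕ) (hd : 1 ≤ d)
    (P : Set (EuclideanSpace ℝ (Fin d))) (hP : IsPolytope d P) (hPconv : Convex ℝ P)
    (A : Set (EuclideanSpace ℝ (Fin d))) :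
    ((∃ σ, WinningI P A σ) ↔ ContainsPerfectSet A) ∧
    ((∃ σ, WinningII P A σ) ↔ A.Countable) := by
  obtain ⟨hPc, hPi, k, a, b, -, hPe⟩ := hP
  have hPeq : ∀ z, z ∈ P ↔ ∀ i, inner ℝ (a i) z ≤ b i := by
    intro z
    rw [hPe]
    simp
  obtain ⟨p0, hp0⟩ : P.Nonempty := hPi.mono interior_subset
  obtain ⟨g, r, N, gcont, g0, gpos, hN, husc, hch, hcov⟩ := chord_data hPc hPi hPconv a b
  refine ⟨⟨fun ⟨σ, hσ⟩ => perfect_of_winI hPc hPeq hp0 hσ, ?_⟩, ?_, winII_of_countable hp0⟩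
  · rintro ⟨F, hFA, hF, hne⟩
    obtain ⟨n, Y, hYF, hY, h1, h2⟩ := ramsey_aux r N hN F (uncountable_of_perfect hF hne)
    obtain ⟨J, J', hJ⟩ := hch n
    have H : ChordSys P a b g r n J J' := ⟨hPc, hPeq, gcont, g0, gpos, hJ, hcov⟩
    obtain ⟨G, hGY, hGs, hG⟩ := good_set r husc Set.Countable (fun s t hst ht => ht.mono hst)
      (fun S hS hs => hS.sUnion hs) (fun s hs => hs) n Y hY h1 h2
    have hne' : ∀ s : Set (EuclideanSpace ℝ (Fin d)), ¬ s.Countable → s.Nonempty := by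
      intro s hs
      by_contra h
      rw [Set.not_nonempty_iff_eq_empty] at h
      exact hs (by rw [h]; exact Set.countable_empty)
    refine winI_of_good H hF.closed hFA (hGY.trans hYF) (hne' G hGs) fun u hu ε hε => ?_
    exact ⟨hne' _ (hG u hu ε hε).1, hne' _ (hG u hu ε hε).2⟩
  · rintro ⟨τ, hτ⟩
    by_contra hA
    obtain ⟨n, Y, hYA, hY, h1, h2⟩ := ramsey_aux r N hN A hA
    obtain ⟨J, J', hJ⟩ := hch n
    have H : ChordSys P a b g r n J J' := ⟨hPc, hPeq, gcont, g0, gpos, hJ, hcov⟩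
    exact hY (countable_of_winII H husc hYA h1 h2 hτ)
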